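/- There exists a Mazurkiewicz set M ⊆ ℝ × ℝ such that for every θ ∈ ℝ and every function f : ℝ → ℝ whose graph {(x, f x) | x ∈ ℝ} is contained in ρ_θ(M), the function f is not a Sierpiński–Zygmund function. -/

import Mathlib

open Cardinal Set

noncomputable section

/-- The line through `p` with direction `v`. -/
def lineThrough (p v : ℝ × ℝ) : Set (ℝ × ℝ) := {q | ∃ t : ℝ, q = p + t • v}

/-- `L` is a straight line of `ℝ²`. -/
def IsLine (L : Set (ℝ × ℝ)) : Prop := ∃ p v : ℝ × ℝ, v ≠ 0 ∧ L = lineThrough p v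

/-- `L` is a vertical line of `ℝ²`. -/
def IsVerticalLine (L : Set (ℝ × ℝ)) : Prop := ∃ x : ℝ, L = {p : ℝ × ℝ | p.1 = x}

/-- `L₁` and `L₂` are parallel lines. -/
def ParallelLines (L₁ L₂ : Set (ℝ × ℝ)) : Prop :=
  ∃ (p₁ p₂ v : ℝ × ℝ) (c : ℝ), v ≠ 0 ∧ c ≠ 0 ∧
    L₁ = lineThrough p₁ v ∧ L₂ = lineThrough p₂ (c • v)

/-- A Mazurkiewicz set meets every line in exactly two points. -/
def IsMazurkiewicz (M : Set (ℝ × ℝ)) : Prop :=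
  ∀ L : Set (ℝ × ℝ), IsLine L → (M ∩ L).encard = 2

/-- The graph of a partial function `g` defined on `S ⊆ ℝ`. -/
def graphOn (S : Set ℝ) (g : S → ℝ) : Set (ℝ × ℝ) := {p | ∃ x : S, p = ((x : ℝ), g x)}

/-- The graph of a function `f : ℝ → ℝ`. -/
def graphOf (f : ℝ → ℝ) : Set (ℝ × ℝ) := {p | ∃ x : ℝ, p = (x, f x)}

/-- A Sierpiński–Zygmund set. -/
def IsSZSet (X : Set (ℝ × ℝ)) : Prop :=
  ∀ (S : Set ℝ) (g : S → ℝ), Continuous g →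
    #↥(X ∩ graphOn S g) < Cardinal.continuum

/-- A Sierpiński–Zygmund function. -/
def IsSZFun (f : ℝ → ℝ) : Prop :=
  ∀ (S : Set ℝ) (g : S → ℝ), Continuous g →
    #↥{x : S | f x.1 = g x} < Cardinal.continuum

/-- Rotation about the origin by angle `θ`. -/
def rot (θ : ℝ) (p : ℝ × ℝ) : ℝ × ℝ :=
  (p.1 * Real.cos θ - p.2 * Real.sin θ, p.1 * Real.sin θ + p.2 * Real.cos θ)

/-- A Hamel basis of `ℝ²`: a basis of `ℝ × ℝ` as a vector space over `ℚ`. -/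
def IsHamelBasis (H : Set (ℝ × ℝ)) : Prop :=
  LinearIndependent ℚ ((↑) : H → ℝ × ℝ) ∧ Submodule.span ℚ H = ⊤

/-- A Hamel function: a function whose graph is a Hamel basis of `ℝ²`. -/
def IsHamelFun (h : ℝ → ℝ) : Prop := IsHamelBasis (graphOf h)

/-- Twice the signed area of the triangle `a b c`; it vanishes exactly when they are collinear. -/
def triDet (a b c : ℝ × ℝ) : ℝ := (b.1 - a.1) * (c.2 - a.2) - (b.2 - a.2) * (c.1 - a.1)

/-- No three distinct points of `A` are collinear. -/
def NoThreeCollinear (A : Set (ℝ × ℝ)) : Prop :=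
  ∀ a ∈ A, ∀ b ∈ A, ∀ c ∈ A, a ≠ b → a ≠ c → b ≠ c → triDet a b c ≠ 0

theorem triDet_rotate (a b c : ℝ × ℝ) : triDet b c a = triDet a b c := by
  unfold triDet; ring

theorem triDet_swap (a b c : ℝ × ℝ) : triDet b a c = -triDet a b c := by
  unfold triDet; ring

theorem NoThreeCollinear.insert {A : Set (ℝ × ℝ)} (hA : NoThreeCollinear A) {q : ℝ × ℝ}
    (hq : ∀ a ∈ A, ∀ b ∈ A, a ≠ b → triDet a b q ≠ 0) : NoThreeCollinear (insert q A) := by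
  rintro a (rfl | ha) b (rfl | hb) c (rfl | hc) hab hac hbc
  · exact absurd rfl hab
  · exact absurd rfl hab
  · exact absurd rfl hac
  · rw [← triDet_rotate]
    exact hq b hb c hc hbc
  · exact absurd rfl hbc
  · rw [← triDet_rotate, ← triDet_rotate]
    exact hq c hc a ha hac.symm
  · exact hq a ha b hb hab
  · exact hA a ha b hb c hc hab hac hbc

/-- Fewer than continuum many countable sets do not cover the real line. -/
theorem exists_real_notMem_of_mk_lt_continuum {J : Type} (hJ : #J < continuum) (F : J → Set ℝ)
    (hF : ∀ j, (F j).Countable) : ∃ t, ∀ j, t ∉ F j := by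
  by_contra! h
  have hU : (⋃ j, F j) = Set.univ := by
    ext t
    simpa using h t
  have h1 : #ℝ ≤ #J * ℵ₀ := by
    rw [← mk_univ, ← hU]
    refine (mk_iUnion_le _).trans ?_
    gcongr
    exact ciSup_le' fun j => (hF j).le_aleph0
  rw [mk_real] at h1
  exact absurd h1 (not_le.2 (mul_lt_of_lt aleph0_le_continuum hJ aleph0_lt_continuum))

theorem mk_prod_self_lt_continuum {A : Set (ℝ × ℝ)} (hA : #A < continuum) :
    #(A × A) < continuum := by
  rw [mk_prod, lift_id]
  exact mul_lt_of_lt aleph0_le_continuum hA hA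

/-- A transfinite recursion of length at most the continuum which, while keeping a set free of
collinear triples, fulfils one monotone requirement at each stage by adding finitely many points. -/
theorem exists_noThreeCollinear_forall {ι : Type} (hι : #ι ≤ continuum)
    (T : ι → Set (ℝ × ℝ) → Prop) (hT : ∀ i A B, A ⊆ B → T i A → T i B)
    (step : ∀ i (A : Set (ℝ × ℝ)), #A < continuum → NoThreeCollinear A →
      ∃ B : Set (ℝ × ℝ), B.Finite ∧ NoThreeCollinear (A ∪ B) ∧ T i (A ∪ B)) :
    ∃ M, NoThreeCollinear M ∧ ∀ i, T i M := by
  obtain ⟨_, _, hord⟩ := exists_ord_eq_type_lt ι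
  have step' : ∀ i (A : Set (ℝ × ℝ)), ∃ B : Set (ℝ × ℝ), B.Finite ∧
      (#A < continuum → NoThreeCollinear A → NoThreeCollinear (A ∪ B) ∧ T i (A ∪ B)) := by
    intro i A
    by_cases h : #A < continuum ∧ NoThreeCollinear A
    · obtain ⟨B, h1, h2⟩ := step i A h.1 h.2
      exact ⟨B, h1, fun _ _ => h2⟩
    · exact ⟨∅, finite_empty, fun h1 h2 => absurd ⟨h1, h2⟩ h⟩
  choose G hGfin hG using step'
  let B : ι → Set (ℝ × ℝ) :=
    (wellFounded_lt (α := ι)).fix fun i ih => G i (⋃ j : Iio i, ih j j.2)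
  have hB : ∀ i : ι, B i = G i (⋃ j : Iio i, B j) := fun i => WellFounded.fix_eq _ _ i
  have hcard : ∀ i : ι, #(⋃ j : Iio i, B j : Set (ℝ × ℝ)) < continuum := by
    intro i
    refine lt_of_le_of_lt (b := #(Iio i) * ℵ₀) ?_
      (mul_lt_of_lt aleph0_le_continuum ((mk_Iio_lt i hord).trans_le hι) aleph0_lt_continuum)
    refine (mk_iUnion_le _).trans ?_
    gcongr
    refine ciSup_le' fun j => ?_
    rw [hB]
    exact (hGfin _ _).countable.le_aleph0
  let C : ι → Set (ℝ × ℝ) := fun i => (⋃ j : Iio i, B j) ∪ B i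
  have hBC : ∀ {i j}, i ≤ j → B i ⊆ C j := by
    intro i j hij
    rcases hij.eq_or_lt with rfl | h
    · exact subset_union_right
    · exact (subset_iUnion (fun k : Iio j => B k) ⟨i, h⟩).trans subset_union_left
  have hbase : ∀ S : Set ι, (∀ i ∈ S, NoThreeCollinear (C i)) →
      NoThreeCollinear (⋃ i : S, B i) := by
    intro S hS a ha b hb c hc
    obtain ⟨⟨i, hi⟩, ha⟩ := mem_iUnion.1 ha
    obtain ⟨⟨j, hj⟩, hb⟩ := mem_iUnion.1 hb
    obtain ⟨⟨k, hk⟩, hc⟩ := mem_iUnion.1 hc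
    have hm : max i (max j k) ∈ S := by
      have hmax : ∀ {x y}, x ∈ S → y ∈ S → max x y ∈ S := fun {x y} hx hy => by
        rcases max_choice x y with h | h <;> rwa [h]
      exact hmax hi (hmax hj hk)
    exact hS _ hm a (hBC (le_max_left _ _) ha)
      b (hBC ((le_max_left _ _).trans (le_max_right _ _)) hb)
      c (hBC ((le_max_right _ _).trans (le_max_right _ _)) hc)
  have main : ∀ i, NoThreeCollinear (C i) ∧ T i (C i) := by
    intro i
    induction i using WellFoundedLT.induction with
    | _ i ih =>
    have := hG i _ (hcard i) (hbase (Iio i) fun j hj => (ih j hj).1)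
    rwa [← hB i] at this
  refine ⟨⋃ i : (Set.univ : Set ι), B i, hbase _ fun i _ => (main i).1, fun i => ?_⟩
  refine hT i (C i) _ (union_subset (iUnion_subset fun j => ?_) ?_) (main i).2
  · exact subset_iUnion (fun k : (Set.univ : Set ι) => B k) ⟨j, mem_univ _⟩
  · exact subset_iUnion (fun k : (Set.univ : Set ι) => B k) ⟨i, mem_univ _⟩

theorem encard_inter_lineThrough_eq_two {M : Set (ℝ × ℝ)} (hM : NoThreeCollinear M)
    {p v a b : ℝ × ℝ} (ha : a ∈ M ∩ lineThrough p v) (hb : b ∈ M ∩ lineThrough p v)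
    (hab : a ≠ b) : (M ∩ lineThrough p v).encard = 2 := by
  have : M ∩ lineThrough p v = {a, b} := by
    refine Subset.antisymm ?_ (by rintro x (rfl | rfl) <;> assumption)
    rintro c ⟨hcM, hc⟩
    by_contra h
    simp only [mem_insert_iff, mem_singleton_iff, not_or] at h
    refine hM a ha.1 b hb.1 c hcM hab (Ne.symm h.1) (Ne.symm h.2) ?_
    obtain ⟨s, rfl⟩ := ha.2
    obtain ⟨t, rfl⟩ := hb.2
    obtain ⟨u, rfl⟩ := hc
    simp only [triDet, Prod.fst_add, Prod.snd_add, Prod.smul_fst, Prod.smul_snd, smul_eq_mul]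
    ring
  rw [this, encard_pair hab]

/-- The set `A` has two distinct points on the line through `p` with direction `v`. -/
def HasTwoOn (p v : ℝ × ℝ) (A : Set (ℝ × ℝ)) : Prop :=
  ∃ a ∈ A ∩ lineThrough p v, ∃ b ∈ A ∩ lineThrough p v, a ≠ b

theorem exists_insert_on_line {A : Set (ℝ × ℝ)} (hc : #A < continuum) (hA : NoThreeCollinear A)
    {p v : ℝ × ℝ} (hv : v ≠ 0) (h2 : ¬ HasTwoOn p v A) :
    ∃ q ∈ lineThrough p v, q ∉ A ∧ NoThreeCollinear (insert q A) := by
  obtain ⟨t, ht⟩ := exists_real_notMem_of_mk_lt_continuum (mk_prod_self_lt_continuum hc)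
    (fun j => {t : ℝ | (j.1 : ℝ × ℝ) ≠ j.2 ∧ triDet j.1 j.2 (p + t • v) = 0} ∪
      {t : ℝ | p + t • v = j.1}) (by
    rintro ⟨⟨a, ha⟩, ⟨b, hb⟩⟩
    refine Countable.union (Set.Subsingleton.countable ?_) (Set.Subsingleton.countable ?_)
    · rintro s ⟨hab, hs⟩ t ⟨-, ht⟩
      by_contra hst
      have hst' : s - t ≠ 0 := sub_ne_zero.2 hst
      simp only [triDet, Prod.fst_add, Prod.snd_add, Prod.smul_fst, Prod.smul_snd,
        smul_eq_mul] at hs ht hab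
      have h1 : (b.1 - a.1) * v.2 - (b.2 - a.2) * v.1 = 0 := by
        apply mul_left_cancel₀ hst'
        linear_combination hs - ht
      have h3 : (b.1 - a.1) * (p.2 - a.2) - (b.2 - a.2) * (p.1 - a.1) = 0 := by
        linear_combination hs - s * h1
      have hN : v.1 ^ 2 + v.2 ^ 2 ≠ 0 := by
        intro h0
        apply hv
        ext <;> simp <;> nlinarith [sq_nonneg v.1, sq_nonneg v.2]
      have hd : (b.1 - a.1) ^ 2 + (b.2 - a.2) ^ 2 ≠ 0 := by
        intro h0
        apply hab
        ext <;> nlinarith [sq_nonneg (b.1 - a.1), sq_nonneg (b.2 - a.2)]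
      have h4 : (a.1 - p.1) * v.2 - (a.2 - p.2) * v.1 = 0 := by
        apply mul_left_cancel₀ hd
        linear_combination ((b.1 - a.1) * (a.1 - p.1) + (b.2 - a.2) * (a.2 - p.2)) * h1
          + ((b.1 - a.1) * v.1 + (b.2 - a.2) * v.2) * h3
      have h5 : (b.1 - p.1) * v.2 - (b.2 - p.2) * v.1 = 0 := by
        linear_combination h1 + h4
      have key : ∀ c : ℝ × ℝ, (c.1 - p.1) * v.2 - (c.2 - p.2) * v.1 = 0 →
          c ∈ lineThrough p v := by
        intro c h
        refine ⟨((c.1 - p.1) * v.1 + (c.2 - p.2) * v.2) / (v.1 ^ 2 + v.2 ^ 2), ?_⟩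
        ext
        · simp only [Prod.fst_add, Prod.smul_fst, smul_eq_mul]
          field_simp
          linear_combination v.2 * h
        · simp only [Prod.snd_add, Prod.smul_snd, smul_eq_mul]
          field_simp
          linear_combination -v.1 * h
      exact h2 ⟨a, ⟨ha, key a h4⟩, b, ⟨hb, key b h5⟩, hab⟩
    · intro s hs t ht
      have hs' : p + s • v = a := hs
      have ht' : p + t • v = a := ht
      exact smul_left_injective ℝ hv (add_left_cancel (hs'.trans ht'.symm)))
  refine ⟨p + t • v, ⟨t, rfl⟩, fun hmem => ht (⟨_, hmem⟩, ⟨_, hmem⟩) (Or.inr rfl),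
    hA.insert fun a ha b hb hab h0 => ht (⟨a, ha⟩, ⟨b, hb⟩) (Or.inl ⟨hab, h0⟩)⟩

theorem exists_finite_union_hasTwoOn {A : Set (ℝ × ℝ)} (hc : #A < continuum)
    (hA : NoThreeCollinear A) {p v : ℝ × ℝ} (hv : v ≠ 0) :
    ∃ B : Set (ℝ × ℝ), B.Finite ∧ NoThreeCollinear (A ∪ B) ∧ HasTwoOn p v (A ∪ B) := by
  by_cases h : HasTwoOn p v A
  · exact ⟨∅, finite_empty, by simpa using hA, by simpa using h⟩
  obtain ⟨q, hq, hqA, hins⟩ := exists_insert_on_line hc hA hv h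
  by_cases h' : HasTwoOn p v (insert q A)
  · exact ⟨{q}, finite_singleton q, by simpa using hins, by simpa using h'⟩
  have hc' : #(insert q A : Set (ℝ × ℝ)) < continuum :=
    mk_insert_le.trans_lt (add_lt_of_lt aleph0_le_continuum hc
      (one_lt_aleph0.trans aleph0_lt_continuum))
  obtain ⟨q', hq', hqA', hins'⟩ := exists_insert_on_line hc' hins hv h'
  have e : A ∪ {q', q} = insert q' (insert q A) := by
    ext; simp
  refine ⟨{q', q}, by simp, by rwa [e], ?_⟩
  rw [e]
  exact ⟨q, ⟨by simp, hq⟩, q', ⟨by simp, hq'⟩, fun h0 => hqA' (h0 ▸ mem_insert q A)⟩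

theorem finite_quadratic_zeros {k l m : ℝ} (hk : k ≠ 0) :
    {x : ℝ | k * x ^ 2 + l * x + m = 0}.Finite := by
  rcases eq_empty_or_nonempty {x : ℝ | k * x ^ 2 + l * x + m = 0} with h | ⟨y, hy⟩
  · simp [h]
  refine (toFinite {y, -l / k - y}).subset fun x hx => ?_
  simp only [mem_ofPred_eq, mem_insert_iff, mem_singleton_iff] at *
  have : (x - y) * (k * (x + y) + l) = 0 := by linear_combination hx - hy
  rcases mul_eq_zero.1 this with h | h
  · exact Or.inl (by linarith)
  · right
    field_simp
    linarith

theorem rot_rot_neg (θ : ℝ) (p : ℝ × ℝ) : rot θ (rot (-θ) p) = p := by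
  have h := Real.sin_sq_add_cos_sq θ
  ext <;> simp only [rot, Real.cos_neg, Real.sin_neg]
  · linear_combination p.1 * h
  · linear_combination p.2 * h

theorem triDet_rot (θ : ℝ) (a b c : ℝ × ℝ) :
    triDet (rot θ a) (rot θ b) (rot θ c) = triDet a b c := by
  have h := Real.sin_sq_add_cos_sq θ
  simp only [rot, triDet]
  linear_combination ((b.1 - a.1) * (c.2 - a.2) - (b.2 - a.2) * (c.1 - a.1)) * h

/-- A line meets each of the two semicircles over `[-1, 1]` in finitely many points. -/
theorem finite_semicircle_inter_line {a b : ℝ × ℝ} (hab : a ≠ b) {ε : ℝ} (hε : ε ^ 2 = 1) :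
    {x : ℝ | x ∈ Ioo (-1 : ℝ) 1 ∧ triDet a b (x, ε * √(1 - x ^ 2)) = 0}.Finite := by
  have hd : (b.1 - a.1) ^ 2 + (b.2 - a.2) ^ 2 ≠ 0 := by
    intro h0
    apply hab
    ext <;> nlinarith [sq_nonneg (b.1 - a.1), sq_nonneg (b.2 - a.2)]
  let w := b.1 - a.1
  let z := b.2 - a.2
  let u := w * a.2 - z * a.1
  refine (finite_quadratic_zeros (l := 2 * u * z) (m := u ^ 2 - w ^ 2) hd).subset ?_
  rintro x ⟨⟨h1, h2⟩, hx⟩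
  have hs : √(1 - x ^ 2) ^ 2 = 1 - x ^ 2 := Real.sq_sqrt (by nlinarith)
  simp only [triDet] at hx
  have hx' : w * (ε * √(1 - x ^ 2)) = z * x + u := by
    simp only [w, z, u]; linear_combination hx
  have hsq : w ^ 2 * (1 - x ^ 2) = (z * x + u) ^ 2 := by
    rw [← hx', mul_pow, mul_pow, hε, hs, one_mul]
  change (w ^ 2 + z ^ 2) * x ^ 2 + 2 * u * z * x + (u ^ 2 - w ^ 2) = 0
  linear_combination -hsq

/-- Both points of the unit circle with abscissa `x` belong to the image of `A` under `rot θ`. -/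
def HasCircleChord (θ x : ℝ) (A : Set (ℝ × ℝ)) : Prop :=
  rot (-θ) (x, √(1 - x ^ 2)) ∈ A ∧ rot (-θ) (x, -√(1 - x ^ 2)) ∈ A

theorem exists_finite_union_hasCircleChord {A : Set (ℝ × ℝ)} (hc : #A < continuum)
    (hA : NoThreeCollinear A) (θ : ℝ) {ψ : ℝ → ℝ} (hψ : Function.Injective ψ)
    (hψ1 : ∀ r, ψ r ∈ Ioo (-1 : ℝ) 1) :
    ∃ B : Set (ℝ × ℝ), B.Finite ∧ NoThreeCollinear (A ∪ B) ∧
      ∃ r, HasCircleChord θ (ψ r) (A ∪ B) := by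
  have hrot : Function.Injective (rot θ) := by
    have : Function.LeftInverse (rot (-θ)) (rot θ) := fun p => by
      simpa using rot_rot_neg (-θ) p
    exact this.injective
  obtain ⟨r, hr⟩ := exists_real_notMem_of_mk_lt_continuum (mk_prod_self_lt_continuum hc)
    (fun j => ψ ⁻¹' (({x : ℝ | x ∈ Ioo (-1 : ℝ) 1 ∧ (j.1 : ℝ × ℝ) ≠ j.2 ∧
        triDet (rot θ j.1) (rot θ j.2) (x, 1 * √(1 - x ^ 2)) = 0} ∪
      {x : ℝ | x ∈ Ioo (-1 : ℝ) 1 ∧ (j.1 : ℝ × ℝ) ≠ j.2 ∧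
        triDet (rot θ j.1) (rot θ j.2) (x, -1 * √(1 - x ^ 2)) = 0}) ∪ {(rot θ j.1).1})) (by
    rintro ⟨⟨a, ha⟩, ⟨b, hb⟩⟩
    refine Countable.preimage_of_injOn ?_ hψ.injOn
    refine ((Set.Finite.union ?_ ?_).union (finite_singleton _)).countable
    · by_cases hab : a = b
      · simp [hab]
      · exact (finite_semicircle_inter_line (hrot.ne hab) (by norm_num)).subset
          fun x hx => ⟨hx.1, hx.2.2⟩
    · by_cases hab : a = b
      · simp [hab]
      · exact (finite_semicircle_inter_line (hrot.ne hab) (by norm_num)).subset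
          fun x hx => ⟨hx.1, hx.2.2⟩)
  set x := ψ r with hx
  have hpos : 0 < √(1 - x ^ 2) := by
    have := hψ1 r
    exact Real.sqrt_pos.2 (by nlinarith [this.1, this.2])
  have e : A ∪ {rot (-θ) (x, -√(1 - x ^ 2)), rot (-θ) (x, √(1 - x ^ 2))} =
      insert (rot (-θ) (x, -√(1 - x ^ 2))) (insert (rot (-θ) (x, √(1 - x ^ 2))) A) := by
    ext; simp
  refine ⟨{rot (-θ) (x, -√(1 - x ^ 2)), rot (-θ) (x, √(1 - x ^ 2))}, by simp, ?_, r,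
    by simp [HasCircleChord, ← hx]⟩
  have hvert : ∀ a ∈ A,
      triDet a (rot (-θ) (x, √(1 - x ^ 2))) (rot (-θ) (x, -√(1 - x ^ 2))) ≠ 0 := by
    intro a ha h0
    refine hr (⟨a, ha⟩, ⟨a, ha⟩) (Or.inr ?_)
    rw [← triDet_rot θ, rot_rot_neg, rot_rot_neg] at h0
    simp only [triDet] at h0
    rw [mem_singleton_iff, ← hx]
    have : √(1 - x ^ 2) * (x - (rot θ a).1) = 0 := by linear_combination -h0 / 2
    have := (mul_eq_zero.1 this).resolve_left hpos.ne'
    linarith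
  rw [e]
  refine (hA.insert ?_).insert ?_
  · intro a ha b hb hab h0
    refine hr (⟨a, ha⟩, ⟨b, hb⟩) (Or.inl (Or.inl ⟨hψ1 r, hab, ?_⟩))
    rw [one_mul, ← hx]
    rwa [← triDet_rot θ, rot_rot_neg] at h0
  · rintro a (rfl | ha) b (rfl | hb) hab
    · exact absurd rfl hab
    · rw [triDet_swap]
      exact neg_ne_zero.2 (hvert b hb)
    · exact hvert a ha
    · intro h0
      refine hr (⟨a, ha⟩, ⟨b, hb⟩) (Or.inl (Or.inr ⟨hψ1 r, hab, ?_⟩))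
      rw [neg_one_mul, ← hx]
      rwa [← triDet_rot θ, rot_rot_neg] at h0

/-- A graph in a rotated copy of a set without collinear triples runs through the unit circle
over the endpoints of every chord contained in the copy. -/
theorem eq_or_eq_neg_of_hasCircleChord {M : Set (ℝ × ℝ)} (hM : NoThreeCollinear M) {θ x : ℝ}
    (hx : x ∈ Ioo (-1 : ℝ) 1) (hch : HasCircleChord θ x M) {f : ℝ → ℝ}
    (hf : graphOf f ⊆ rot θ '' M) : f x = √(1 - x ^ 2) ∨ f x = -√(1 - x ^ 2) := by
  obtain ⟨m, hm, hmx⟩ := hf ⟨x, rfl⟩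
  have hpos : 0 < √(1 - x ^ 2) := Real.sqrt_pos.2 (by nlinarith [hx.1, hx.2])
  by_contra! h
  refine hM m hm _ hch.1 _ hch.2 ?_ ?_ ?_ ?_
  · rintro rfl
    rw [rot_rot_neg] at hmx
    exact h.1 (congrArg Prod.snd hmx).symm
  · rintro rfl
    rw [rot_rot_neg] at hmx
    exact h.2 (congrArg Prod.snd hmx).symm
  · intro h0
    have := congrArg (fun p => (rot θ p).2) h0
    simp only [rot_rot_neg] at this
    linarith
  · rw [← triDet_rot θ, rot_rot_neg, rot_rot_neg, hmx]
    simp [triDet]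

theorem not_isSZFun_of_hasCircleChord {M : Set (ℝ × ℝ)} (hM : NoThreeCollinear M) {θ : ℝ}
    {y : ℝ → ℝ} (hy : Function.Injective y) (hy1 : ∀ s, y s ∈ Ioo (-1 : ℝ) 1)
    (hch : ∀ s, HasCircleChord θ (y s) M) {f : ℝ → ℝ} (hf : graphOf f ⊆ rot θ '' M) :
    ¬ IsSZFun f := by
  intro hSZ
  have h1 := hSZ univ (fun x => √(1 - x.1 ^ 2)) (by fun_prop)
  have h2 := hSZ univ (fun x => -√(1 - x.1 ^ 2)) (by fun_prop)
  set U := {x : (univ : Set ℝ) | f x.1 = √(1 - x.1 ^ 2)}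
  set V := {x : (univ : Set ℝ) | f x.1 = -√(1 - x.1 ^ 2)}
  have hle : #ℝ ≤ #(U ∪ V : Set (univ : Set ℝ)) := by
    refine mk_le_of_injective (f := fun s => ⟨⟨y s, mem_univ _⟩,
      eq_or_eq_neg_of_hasCircleChord hM (hy1 s) (hch s) hf⟩) fun s t hst => ?_
    exact hy (congrArg (fun z => (z.1.1 : ℝ)) hst)
  rw [mk_real] at hle
  exact absurd (hle.trans (mk_union_le _ _))
    (not_le.2 (add_lt_of_lt aleph0_le_continuum h1 h2))

/-- There is a Mazurkiewicz set containing no graph of a Sierpiński–Zygmund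
function in any direction. -/
theorem stmt_8 :
    ∃ M : Set (ℝ × ℝ), IsMazurkiewicz M ∧
      ∀ (θ : ℝ) (f : ℝ → ℝ), graphOf f ⊆ rot θ '' M → ¬ IsSZFun f := by
  obtain ⟨φ⟩ : Nonempty (ℝ × ℝ ≃ Ioo (-1 : ℝ) 1) := by
    rw [← Cardinal.eq, mk_Ioo_real (by norm_num)]
    simp [mk_real]
  have hφ : Function.Injective fun p => (φ p : ℝ) := Subtype.val_injective.comp φ.injective
  obtain ⟨M, hM, hT⟩ := exists_noThreeCollinear_forall
    (ι := ((ℝ × ℝ) × (ℝ × ℝ)) ⊕ (ℝ × ℝ)) (by simp [mk_real])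
    (Sum.elim (fun l A => l.2 ≠ 0 → HasTwoOn l.1 l.2 A)
      (fun d A => ∃ r, HasCircleChord d.1 (φ (d.2, r)) A))
    (by
      rintro (l | d) A B hAB
      · intro h hl
        obtain ⟨a, ha, b, hb, hab⟩ := h hl
        exact ⟨a, ⟨hAB ha.1, ha.2⟩, b, ⟨hAB hb.1, hb.2⟩, hab⟩
      · rintro ⟨r, h1, h2⟩
        exact ⟨r, hAB h1, hAB h2⟩)
    (by
      rintro (l | d) A hc hA
      · by_cases hl : l.2 = 0
        · exact ⟨∅, finite_empty, by simpa using hA, fun h => absurd hl h⟩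
        · obtain ⟨B, h1, h2, h3⟩ := exists_finite_union_hasTwoOn (p := l.1) hc hA hl
          exact ⟨B, h1, h2, fun _ => h3⟩
      · exact exists_finite_union_hasCircleChord hc hA d.1 (ψ := fun r => φ (d.2, r))
          (fun r r' h => (Prod.ext_iff.1 (hφ h)).2) fun r => (φ _).2)
  refine ⟨M, ?_, fun θ f hf => ?_⟩
  · rintro L ⟨p, v, hv, rfl⟩
    obtain ⟨a, ha, b, hb, hab⟩ := hT (Sum.inl (p, v)) hv
    exact encard_inter_lineThrough_eq_two hM ha hb hab
  · choose r hr using fun s => hT (Sum.inr (θ, s))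
    exact not_isSZFun_of_hasCircleChord hM (y := fun s => φ (s, r s))
      (fun s t h => (Prod.ext_iff.1 (hφ h)).1) (fun s => (φ _).2) hr hf
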